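/- arXiv:1907.03851 — 5 statements merged into one kernel-verified Lean document; each statement's English description precedes it below -/
import Mathlib

section
/- Let (X, φ) be a minimal dynamical system with X an infinite compact metric space, and let Y ⊆ X be a nonempty closed subset meeting every orbit at most once. Then the orbit-breaking relation R_Y is minimal: every R_Y-equivalence class is dense in X. -/
/-- The orbit equivalence relation `R_φ = {(x, φⁿ x) : x ∈ X, n ∈ ℤ}` of a homeomorphism. -/
def orbitRel {X : Type*} [TopologicalSpace X] (φ : X ≃ₜ X) : Set (X × X) :=
  {p : X × X | ∃ n : ℤ, (φ.toEquiv ^ n) p.1 = p.2}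

/-- The orbit-breaking relation
`R_Y = R_φ \ {(φᵏ y, φˡ y) : y ∈ Y, (l < 1 ≤ k or k < 1 ≤ l)}`. -/
def orbitBreakRel {X : Type*} [TopologicalSpace X] (φ : X ≃ₜ X) (Y : Set X) : Set (X × X) :=
  orbitRel φ \
    {p : X × X | ∃ y ∈ Y, ∃ k l : ℤ,
      ((l < 1 ∧ 1 ≤ k) ∨ (k < 1 ∧ 1 ≤ l)) ∧
      p = ((φ.toEquiv ^ k) y, (φ.toEquiv ^ l) y)}

/-- Integer powers of a homeomorphism are continuous. -/
theorem continuous_toEquiv_zpow {X : Type*} [TopologicalSpace X] (φ : X ≃ₜ X) (k : ℤ) :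
    Continuous (φ.toEquiv ^ k) := by
  cases k with
  | ofNat n =>
    rw [Int.ofNat_eq_natCast, zpow_natCast, ← Equiv.Perm.iterate_eq_pow]
    exact φ.continuous.iterate n
  | negSucc n =>
    rw [zpow_negSucc, ← inv_pow, ← Equiv.Perm.iterate_eq_pow]
    exact φ.symm.continuous.iterate (n + 1)

open Filter Topology in
/-- In a compact minimal system, the orbit of any point along a set of times `S` is dense as soon
as every translate of `S` belongs to some fixed proper filter on `ℤ`. -/
theorem dense_zpow_image_of_eventually {X : Type*} [TopologicalSpace X] [CompactSpace X]
    (φ : X ≃ₜ X) (hmin : ∀ x : X, Dense (Set.range fun n : ℤ => (φ.toEquiv ^ n) x))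
    (F : Filter ℤ) [F.NeBot] (S : Set ℤ) (hS : ∀ k : ℤ, ∀ᶠ n in F, k + n ∈ S) (x : X) :
    Dense ((fun n : ℤ => (φ.toEquiv ^ n) x) '' S) := by
  obtain ⟨z, hz⟩ := exists_clusterPt_of_compactSpace (F.map fun n : ℤ => (φ.toEquiv ^ n) x)
  rw [dense_iff_inter_open]
  intro U hU hUne
  obtain ⟨_, hkU, k, rfl⟩ := (hmin z).inter_open_nonempty U hU hUne
  have hV : (φ.toEquiv ^ k) ⁻¹' U ∈ 𝓝 z := (hU.preimage (continuous_toEquiv_zpow φ k)).mem_nhds hkU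
  have hz' : MapClusterPt z F fun n : ℤ => (φ.toEquiv ^ n) x := hz
  obtain ⟨n, hnU, hnS⟩ := ((hz'.frequently hV).and_eventually (hS k)).exists
  refine ⟨(φ.toEquiv ^ (k + n)) x, ?_, k + n, hnS, rfl⟩
  rw [zpow_add, Equiv.Perm.mul_apply]
  exact hnU

/-- If `Y` meets every orbit at most once, a point in the orbit of `Y` determines both the time
and the point of `Y`. -/
theorem eq_of_zpow_apply_eq {X : Type*} {σ : Equiv.Perm X} {Y : Set X}
    (hY : ∀ n : ℤ, n ≠ 0 → (⇑(σ ^ n) '' Y) ∩ Y = ∅) {y y' : X} (hy : y ∈ Y) (hy' : y' ∈ Y)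
    {m k : ℤ} (h : (σ ^ m) y = (σ ^ k) y') : m = k ∧ y = y' := by
  have h' : (σ ^ (-k + m)) y = y' := by
    rw [zpow_add, Equiv.Perm.mul_apply, h, ← Equiv.Perm.mul_apply, ← zpow_add, neg_add_cancel,
      zpow_zero, Equiv.Perm.one_apply]
  have hmk : m = k := by
    by_contra hne
    have hmem : y' ∈ (⇑(σ ^ (-k + m)) '' Y) ∩ Y := ⟨⟨y, hy, h'⟩, hy'⟩
    rw [hY _ (by omega)] at hmem
    exact hmem
  subst hmk
  exact ⟨rfl, (σ ^ m).injective h⟩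

/-- Points of the orbit of `y ∈ Y` whose times are both positive or both nonpositive remain
equivalent after breaking the orbit at `Y`. -/
theorem zpow_mem_orbitBreakRel {X : Type*} [TopologicalSpace X] {φ : X ≃ₜ X} {Y : Set X}
    (hY : ∀ n : ℤ, n ≠ 0 → (⇑(φ.toEquiv ^ n) '' Y) ∩ Y = ∅) {y : X} (hy : y ∈ Y) {m l : ℤ}
    (hml : 1 ≤ m ↔ 1 ≤ l) :
    ((φ.toEquiv ^ m) y, (φ.toEquiv ^ l) y) ∈ orbitBreakRel φ Y := by
  refine ⟨⟨l - m, ?_⟩, ?_⟩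
  · rw [← Equiv.Perm.mul_apply, ← zpow_add, sub_add_cancel]
  · rintro ⟨y', hy', k, l', hkl, hp⟩
    have hmk := (eq_of_zpow_apply_eq hY hy hy' (Prod.ext_iff.mp hp).1).1
    have hll := (eq_of_zpow_apply_eq hY hy hy' (Prod.ext_iff.mp hp).2).1
    omega

/-- Let `(X, φ)` be a minimal dynamical system with `X` an infinite compact
metric space, and `Y ⊆ X` a nonempty closed subset meeting every orbit at most once.
Then the orbit-breaking relation `R_Y` is minimal: every `R_Y`-equivalence class is
dense in `X`. -/
theorem orbitBreakRel_minimal {X : Type*} [MetricSpace X] [CompactSpace X] [Infinite X]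
    (φ : X ≃ₜ X)
    (hmin : ∀ x : X, Dense (Set.range fun n : ℤ => (φ.toEquiv ^ n) x))
    (Y : Set X) (hYne : Y.Nonempty) (hYcl : IsClosed Y)
    (hY : ∀ n : ℤ, n ≠ 0 → (⇑(φ.toEquiv ^ n) '' Y) ∩ Y = ∅) :
    ∀ x : X, Dense {z : X | (x, z) ∈ orbitBreakRel φ Y} := by
  intro x
  by_cases hx : ∃ y ∈ Y, ∃ m : ℤ, (φ.toEquiv ^ m) y = x
  · obtain ⟨y, hy, m, rfl⟩ := hx
    by_cases hm : 1 ≤ m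
    · refine (dense_zpow_image_of_eventually φ hmin Filter.atTop (Set.Ici 1) (fun k => ?_) y).mono ?_
      · filter_upwards [Filter.eventually_ge_atTop (1 - k)] with n hn
        rw [Set.mem_Ici]
        omega
      · rintro _ ⟨l, hl, rfl⟩
        exact zpow_mem_orbitBreakRel hY hy (iff_of_true hm hl)
    · refine (dense_zpow_image_of_eventually φ hmin Filter.atBot (Set.Iio 1) (fun k => ?_) y).mono ?_
      · filter_upwards [Filter.eventually_le_atBot (-k)] with n hn
        rw [Set.mem_Iio]
        omega
      · rintro _ ⟨l, hl, rfl⟩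
        exact zpow_mem_orbitBreakRel hY hy (iff_of_false hm (not_le.mpr hl))
  · refine (hmin x).mono ?_
    rintro _ ⟨n, rfl⟩
    refine ⟨⟨n, rfl⟩, ?_⟩
    rintro ⟨y, hy, k, l, -, hp⟩
    exact hx ⟨y, hy, k, (Prod.ext_iff.mp hp).1.symm⟩
end

section
/- Let X be a compact Hausdorff space and Y a Hausdorff topological space, let φ : X → X and ψ : Y → Y be homeomorphisms, and let π : X → Y be a continuous surjection with π ∘ φ = ψ ∘ π. Suppose (Y, ψ) is minimal and there is a dense subset D ⊆ X such that π⁻¹({π(d)}) = {d} for every d ∈ D. Then (X, φ) is minimal, i.e., the only closed subsets F ⊆ X with φ(F) = F are ∅ and X. -/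
/-- Let `X` be compact Hausdorff, `Y` Hausdorff, `φ, ψ` homeomorphisms, and
`π : X → Y` a continuous surjection with `π ∘ φ = ψ ∘ π`.  Suppose `(Y, ψ)` is minimal
(the only closed `ψ`-invariant subsets are `∅` and `Y`) and there is a dense set `D ⊆ X`
with `π⁻¹({π d}) = {d}` for every `d ∈ D`.  Then `(X, φ)` is minimal. -/
theorem almost_one_to_one_extension_minimal {X Y : Type*}
    [TopologicalSpace X] [CompactSpace X] [T2Space X] [TopologicalSpace Y] [T2Space Y]
    (φ : X ≃ₜ X) (ψ : Y ≃ₜ Y)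
    (π : X → Y) (hπc : Continuous π) (hπs : Function.Surjective π)
    (hcomm : ∀ x : X, π (φ x) = ψ (π x))
    (hmin : ∀ F : Set Y, IsClosed F → ⇑ψ '' F = F → F = ∅ ∨ F = Set.univ)
    (D : Set X) (hD : Dense D) (hfib : ∀ d ∈ D, π ⁻¹' {π d} = {d}) :
    ∀ F : Set X, IsClosed F → ⇑φ '' F = F → F = ∅ ∨ F = Set.univ := by
  intro F hF hφF
  have hinv : ⇑ψ '' (π '' F) = π '' F := by
    conv_rhs => rw [← hφF]
    simp only [Set.image_image, hcomm]
  rcases hmin (π '' F) (hF.isCompact.image hπc).isClosed hinv with h | h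
  · exact Or.inl (Set.image_eq_empty.mp h)
  · refine Or.inr (Set.eq_univ_of_univ_subset ?_)
    rw [← hD.closure_eq]
    refine closure_minimal (fun d hd => ?_) hF
    obtain ⟨x, hxF, hx⟩ : π d ∈ π '' F := h ▸ Set.mem_univ _
    have hxd : x ∈ π ⁻¹' {π d} := hx
    rw [hfib d hd] at hxd
    exact Set.mem_singleton_iff.mp hxd ▸ hxF
end

section
/- Let X and Y be compact metric spaces, φ : X → X and ψ : Y → Y homeomorphisms, and π : X → Y a continuous surjection with π ∘ φ = ψ ∘ π. Suppose D ⊆ X is a Borel set with φ(D) = D, π is injective on D, π⁻¹(π(D)) = D, every φ-invariant Borel probability measure μ on X satisfies μ(D) = 1, and every ψ-invariant Borel probability measure ν on Y satisfies ν(π(D)) = 1. Then the pushforward map μ ↦ π_*μ is a bijection from the set of φ-invariant Borel probability measures on X onto the set of ψ-invariant Borel probability measures on Y. -/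
open MeasureTheory

/-- If `f` is injective on the saturated set `D`, every subset of `D` is saturated. -/
theorem Set.InjOn.preimage_image_inter_of_saturated {α β : Type*} {f : α → β} {D : Set α}
    (hInj : Set.InjOn f D) (hSat : f ⁻¹' (f '' D) = D) (B : Set α) :
    f ⁻¹' (f '' (B ∩ D)) = B ∩ D := by
  refine Set.Subset.antisymm ?_ (Set.subset_preimage_image _ _)
  rintro x ⟨z, ⟨hzB, hzD⟩, hzx⟩
  have hxD : x ∈ D := hSat ▸ (⟨z, hzD, hzx⟩ : x ∈ f ⁻¹' (f '' D))
  exact hInj hzD hxD hzx ▸ ⟨hzB, hzD⟩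

/-- A semiconjugacy carries preimages inside an invariant set to preimages of images. -/
theorem Function.Semiconj.image_preimage_inter {α β : Type*} {f : α → β} {φ : α → α} {ψ : β → β}
    (h : Function.Semiconj f φ ψ) (hψ : Function.Injective ψ)
    {D : Set α} (hD : φ '' D = D) (B : Set α) :
    f '' (φ ⁻¹' B ∩ D) = ψ ⁻¹' (f '' (B ∩ D)) := by
  ext y
  constructor
  · rintro ⟨x, ⟨hxB, hxD⟩, rfl⟩
    exact ⟨φ x, ⟨hxB, hD ▸ Set.mem_image_of_mem φ hxD⟩, h x⟩
  · rintro ⟨z, ⟨hzB, hzD⟩, hzy⟩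
    obtain ⟨x, hxD, rfl⟩ : z ∈ φ '' D := hD.symm ▸ hzD
    exact ⟨x, ⟨hzB, hxD⟩, hψ ((h x).symm.trans hzy)⟩

/-- A measure on the target of a map `f` that is measurably injective on `D` lifts to a measure
on the source, supported on `D`. -/
theorem MeasureTheory.Measure.exists_apply_eq_image_inter {α β : Type*} [MeasurableSpace α]
    [MeasurableSpace β] {f : α → β} {D : Set α} (hInj : Set.InjOn f D)
    (hf : ∀ B, MeasurableSet B → MeasurableSet (f '' (B ∩ D))) (ν : Measure β) :
    ∃ μ : Measure α, ∀ B, MeasurableSet B → μ B = ν (f '' (B ∩ D)) := by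
  have himage (B : Set α) : D.domRestrict f '' (Subtype.val ⁻¹' B) = f '' (B ∩ D) := by
    rw [Set.domRestrict_eq, Set.image_comp, Subtype.image_preimage_coe, Set.inter_comm]
  refine ⟨(ν.comap (D.domRestrict f)).map Subtype.val, fun B hB ↦ ?_⟩
  rw [Measure.map_apply measurable_subtype_coe hB,
    Measure.comap_apply _ hInj.injective _ _ (measurable_subtype_coe hB), himage]
  rintro _ ⟨B, hB, rfl⟩
  exact himage B ▸ hf B hB

/-- Let `X, Y` be compact metric spaces, `φ, ψ` homeomorphisms, `π : X → Y` a
continuous surjection with `π ∘ φ = ψ ∘ π`.  Suppose `D ⊆ X` is Borel with `φ(D) = D`, `π`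
injective on `D`, `π⁻¹(π(D)) = D`, every `φ`-invariant Borel probability measure gives `D`
full measure, and every `ψ`-invariant Borel probability measure gives `π(D)` full measure.
Then `μ ↦ π_* μ` is a bijection from the `φ`-invariant Borel probability measures on `X`
onto the `ψ`-invariant Borel probability measures on `Y`. -/
theorem pushforward_bijection_invariant_measures {X Y : Type*}
    [MetricSpace X] [CompactSpace X] [MeasurableSpace X] [BorelSpace X]
    [MetricSpace Y] [CompactSpace Y] [MeasurableSpace Y] [BorelSpace Y]
    (φ : X ≃ₜ X) (ψ : Y ≃ₜ Y)
    (π : X → Y) (hπc : Continuous π) (hπs : Function.Surjective π)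
    (hcomm : ∀ x : X, π (φ x) = ψ (π x))
    (D : Set X) (hDm : MeasurableSet D) (hDinv : ⇑φ '' D = D)
    (hInj : Set.InjOn π D) (hSat : π ⁻¹' (π '' D) = D)
    (hμD : ∀ μ : Measure X, IsProbabilityMeasure μ →
      (∀ B : Set X, MeasurableSet B → μ (⇑φ ⁻¹' B) = μ B) → μ D = 1)
    (hνD : ∀ ν : Measure Y, IsProbabilityMeasure ν →
      (∀ B : Set Y, MeasurableSet B → ν (⇑ψ ⁻¹' B) = ν B) → ν (π '' D) = 1) :
    Set.BijOn (fun μ : Measure X => Measure.map π μ)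
      {μ : Measure X | IsProbabilityMeasure μ ∧
        ∀ B : Set X, MeasurableSet B → μ (⇑φ ⁻¹' B) = μ B}
      {ν : Measure Y | IsProbabilityMeasure ν ∧
        ∀ B : Set Y, MeasurableSet B → ν (⇑ψ ⁻¹' B) = ν B} := by
  have himage (B : Set X) (hB : MeasurableSet B) : MeasurableSet (π '' (B ∩ D)) :=
    (hB.inter hDm).image_of_continuousOn_injOn hπc.continuousOn (hInj.mono Set.inter_subset_right)
  have hsat := hInj.preimage_image_inter_of_saturated hSat
  refine ⟨?_, ?_, ?_⟩
  · rintro μ ⟨hμ, hinv⟩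
    refine ⟨Measure.isProbabilityMeasure_map hπc.aemeasurable, fun B hB ↦ ?_⟩
    dsimp only
    rw [Measure.map_apply hπc.measurable (ψ.continuous.measurable hB),
      Measure.map_apply hπc.measurable hB, ← hinv _ (hπc.measurable hB)]
    congr 1
    ext x
    simp [hcomm]
  · rintro μ₁ ⟨hμ₁, hinv₁⟩ μ₂ ⟨hμ₂, hinv₂⟩ heq
    have hmap (μ : Measure X) (hμ : IsProbabilityMeasure μ)
        (hinv : ∀ B : Set X, MeasurableSet B → μ (⇑φ ⁻¹' B) = μ B)
        (B : Set X) (hB : MeasurableSet B) : μ B = μ.map π (π '' (B ∩ D)) := by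
      rw [Measure.map_apply hπc.measurable (himage B hB), hsat]
      exact (measure_inter_conull ((prob_compl_eq_zero_iff hDm).2 (hμD μ hμ hinv))).symm
    ext B hB
    rw [hmap μ₁ hμ₁ hinv₁ B hB, hmap μ₂ hμ₂ hinv₂ B hB]
    exact congrArg (fun ν : Measure Y ↦ ν (π '' (B ∩ D))) heq
  · rintro ν ⟨hν, hinv⟩
    obtain ⟨μ, hμ⟩ := Measure.exists_apply_eq_image_inter hInj himage ν
    have hπD : MeasurableSet (π '' D) := by simpa using himage _ MeasurableSet.univ
    refine ⟨μ, ⟨⟨?_⟩, fun B hB ↦ ?_⟩, ?_⟩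
    · rw [hμ _ MeasurableSet.univ, Set.univ_inter, hνD ν hν hinv]
    · rw [hμ _ (φ.continuous.measurable hB), hμ _ hB,
        Function.Semiconj.image_preimage_inter hcomm ψ.injective hDinv, hinv _ (himage B hB)]
    · ext B hB
      rw [Measure.map_apply hπc.measurable hB, hμ _ (hπc.measurable hB), Set.inter_comm,
        Set.image_inter_preimage, Set.inter_comm]
      exact measure_inter_conull ((prob_compl_eq_zero_iff hπD).2 (hνD ν hν hinv))
end

section
/- Let (X, d) be a compact metric space, 𝒰 a finite open cover of X, N ≥ 1, and α ∈ Homeo(X). Suppose ℱ is a finite closed cover of X that refines 𝒰 ∨ α⁻¹(𝒰) ∨ ⋯ ∨ α^{−N+1}(𝒰). Then there exists δ > 0 such that for every β ∈ Homeo(X) with ρ(α, β) < δ, the cover ℱ refines 𝒰 ∨ β⁻¹(𝒰) ∨ ⋯ ∨ β^{−N+1}(𝒰). -/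
/-- The metric `ρ(g,h) = sup_x d(g x, h x) + sup_x d(g⁻¹ x, h⁻¹ x)` on `Homeo(X)`. -/
noncomputable def homeoDist {X : Type*} [MetricSpace X] (g h : X ≃ₜ X) : ℝ :=
  (⨆ x : X, dist (g x) (h x)) + (⨆ x : X, dist (g.symm x) (h.symm x))

-- The order of a finite cover: `ord(𝒰) = max_x Σ_{U ∈ 𝒰} χ_U(x) − 1`.
open Classical in
noncomputable def coverOrd {X : Type*} (U : Finset (Set X)) : ℕ :=
  ⨆ x : X, ((U.filter fun u => x ∈ u).card - 1)

/-- `𝒟(𝒰)`: the minimal order of a finite open cover refining `𝒰`. -/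
noncomputable def coverD {X : Type*} [TopologicalSpace X] (U : Set (Set X)) : ℕ :=
  sInf {m : ℕ | ∃ V : Finset (Set X), (∀ v ∈ V, IsOpen v) ∧
    ⋃₀ (V : Set (Set X)) = Set.univ ∧ (∀ v ∈ V, ∃ u ∈ U, v ⊆ u) ∧ coverOrd V = m}

/-- The join `𝒰 ∨ α⁻¹(𝒰) ∨ ⋯ ∨ α^{-n+1}(𝒰)`: its members are the sets
`⋂_{r=0}^{n-1} α^{-r}(U_r)` with each `U_r ∈ 𝒰`. -/
def joinCover {X : Type*} [TopologicalSpace X] (U : Set (Set X)) (α : X ≃ₜ X) (n : ℕ) :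
    Set (Set X) :=
  {V : Set X | ∃ f : Fin n → Set X, (∀ r, f r ∈ U) ∧
    V = ⋂ r : Fin n, ⇑(α.toEquiv ^ (r : ℕ)) ⁻¹' f r}

/-- `𝒟(𝒰, α, n) = 𝒟(𝒰 ∨ α⁻¹(𝒰) ∨ ⋯ ∨ α^{-n+1}(𝒰))`. -/
noncomputable def coverDn {X : Type*} [TopologicalSpace X] (U : Set (Set X)) (α : X ≃ₜ X)
    (n : ℕ) : ℕ :=
  coverD (joinCover U α n)

/-- The mean dimension `mdim(α) = sup_𝒰 inf_{n ≥ 1} 𝒟(𝒰, α, n)/n`, the supremum over all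
finite open covers `𝒰` of `X`. -/
noncomputable def mdim {X : Type*} [TopologicalSpace X] (α : X ≃ₜ X) : ENNReal :=
  ⨆ U ∈ {U : Finset (Set X) | (∀ u ∈ U, IsOpen u) ∧ ⋃₀ (U : Set (Set X)) = Set.univ},
    ⨅ n : ℕ, (coverDn (↑U) α (n + 1) : ENNReal) / ((n : ENNReal) + 1)

open Filter Topology

theorem homeoDist_nonneg {X : Type*} [MetricSpace X] (g h : X ≃ₜ X) : 0 ≤ homeoDist g h :=
  add_nonneg (Real.iSup_nonneg fun _ => dist_nonneg) (Real.iSup_nonneg fun _ => dist_nonneg)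

theorem dist_apply_le_homeoDist {X : Type*} [MetricSpace X] [CompactSpace X]
    (g h : X ≃ₜ X) (x : X) : dist (g x) (h x) ≤ homeoDist g h := by
  have hb : BddAbove (Set.range fun x : X => dist (g x) (h x)) :=
    (isCompact_range (g.continuous.dist h.continuous)).bddAbove
  exact (le_ciSup hb x).trans
    (le_add_of_nonneg_right (Real.iSup_nonneg fun _ => dist_nonneg))

theorem continuous_toEquiv_pow {X : Type*} [TopologicalSpace X] (α : X ≃ₜ X) (r : ℕ) :
    Continuous ⇑(α.toEquiv ^ r) := by
  induction r with
  | zero => exact continuous_id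
  | succ r ih =>
    rw [pow_succ']
    exact α.continuous.comp ih

/-- Iterates depend continuously on the homeomorphism, uniformly over the space. -/
theorem tendstoUniformly_toEquiv_pow {X : Type*} [MetricSpace X] [CompactSpace X]
    (α : X ≃ₜ X) (r : ℕ) :
    TendstoUniformly (fun (β : X ≃ₜ X) (x : X) => (β.toEquiv ^ r) x) (⇑(α.toEquiv ^ r))
      (comap (homeoDist α) (𝓝 0)) := by
  rw [Metric.tendstoUniformly_iff]
  induction r with
  | zero =>
    intro ε hε
    exact Eventually.of_forall fun β x => by simpa using hε
  | succ r ih =>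
    intro ε hε
    obtain ⟨η, hη, hα⟩ := Metric.uniformContinuous_iff.1
      (CompactSpace.uniformContinuous_of_continuous α.continuous) (ε / 2) (half_pos hε)
    have hlt : ∀ᶠ β in comap (homeoDist α) (𝓝 0), homeoDist α β < ε / 2 :=
      tendsto_comap.eventually_lt_const (half_pos hε)
    filter_upwards [ih η hη, hlt] with β h₁ h₂ x
    rw [pow_succ', pow_succ']
    calc dist (α ((α.toEquiv ^ r) x)) (β ((β.toEquiv ^ r) x))
        ≤ dist (α ((α.toEquiv ^ r) x)) (α ((β.toEquiv ^ r) x)) +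
          dist (α ((β.toEquiv ^ r) x)) (β ((β.toEquiv ^ r) x)) := dist_triangle _ _ _
      _ < ε / 2 + ε / 2 :=
        add_lt_add (hα (h₁ x)) ((dist_apply_le_homeoDist α β _).trans_lt h₂)
      _ = ε := add_halves ε

/-- If `α ^ r` maps a compact set into an open set, so does `β ^ r` for `β` close to `α`. -/
theorem eventually_subset_preimage_toEquiv_pow {X : Type*} [MetricSpace X] [CompactSpace X]
    (α : X ≃ₜ X) (r : ℕ) {K V : Set X} (hK : IsCompact K) (hV : IsOpen V)
    (hKV : K ⊆ ⇑(α.toEquiv ^ r) ⁻¹' V) :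
    ∀ᶠ β : X ≃ₜ X in comap (homeoDist α) (𝓝 0), K ⊆ ⇑(β.toEquiv ^ r) ⁻¹' V := by
  obtain ⟨ε, hε, hsub⟩ := (hK.image (continuous_toEquiv_pow α r)).exists_thickening_subset_open hV
    (Set.image_subset_iff.2 hKV)
  filter_upwards [Metric.tendstoUniformly_iff.1 (tendstoUniformly_toEquiv_pow α r) ε hε]
    with β h x hx
  exact hsub (Metric.mem_thickening_iff.2
    ⟨_, Set.mem_image_of_mem _ hx, by simpa only [dist_comm] using h x⟩)

/-- Let `(X, d)` be a compact metric space, `𝒰` a finite open cover, `N ≥ 1`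
and `α ∈ Homeo(X)`.  Suppose `ℱ` is a finite closed cover of `X` refining
`𝒰 ∨ α⁻¹(𝒰) ∨ ⋯ ∨ α^{-N+1}(𝒰)`.  Then there is `δ > 0` such that for every
`β ∈ Homeo(X)` with `ρ(α, β) < δ`, the cover `ℱ` refines
`𝒰 ∨ β⁻¹(𝒰) ∨ ⋯ ∨ β^{-N+1}(𝒰)`. -/
theorem refinement_stable_under_perturbation {X : Type*} [MetricSpace X] [CompactSpace X]
    (U : Finset (Set X)) (hUo : ∀ u ∈ U, IsOpen u) (hUc : ⋃₀ (U : Set (Set X)) = Set.univ)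
    (N : ℕ) (hN : 1 ≤ N) (α : X ≃ₜ X)
    (F : Finset (Set X)) (hFcl : ∀ f ∈ F, IsClosed f)
    (hFc : ⋃₀ (F : Set (Set X)) = Set.univ)
    (hFref : ∀ f ∈ F, ∃ V ∈ joinCover (↑U) α N, f ⊆ V) :
    ∃ δ > 0, ∀ β : X ≃ₜ X, homeoDist α β < δ →
      ∀ f ∈ F, ∃ V ∈ joinCover (↑U) β N, f ⊆ V := by
  have hev : ∀ᶠ β : X ≃ₜ X in comap (homeoDist α) (𝓝 0),
      ∀ f ∈ F, ∃ V ∈ joinCover (↑U) β N, f ⊆ V := by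
    rw [Filter.eventually_all_finset]
    intro f hf
    obtain ⟨_, ⟨u, hu, rfl⟩, hfu⟩ := hFref f hf
    have h : ∀ᶠ β : X ≃ₜ X in comap (homeoDist α) (𝓝 0),
        ∀ r : Fin N, f ⊆ ⇑(β.toEquiv ^ (r : ℕ)) ⁻¹' u r :=
      Filter.eventually_all.2 fun r => eventually_subset_preimage_toEquiv_pow α r
        (hFcl f hf).isCompact (hUo _ (hu r)) (hfu.trans (Set.iInter_subset _ r))
    filter_upwards [h] with β hβ
    exact ⟨_, ⟨u, hu, rfl⟩, Set.subset_iInter hβ⟩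
  obtain ⟨δ, hδ, h⟩ := (Metric.nhds_basis_ball.comap (homeoDist α)).eventually_iff.1 hev
  refine ⟨δ, hδ, fun β hβ => h ?_⟩
  simpa [abs_of_nonneg (homeoDist_nonneg α β)] using hβ
end

section
/- Let Y be a compact metric space, let σ : Y^ℤ → Y^ℤ be the shift homeomorphism (σ(x))_l = x_{l−1}, and for each n ≥ 1 define σ_n : Y^ℤ → Y^ℤ by (σ_n(x))_l = x_{l−1} for −n < l ≤ n, (σ_n(x))_{−n} = x_n, and (σ_n(x))_l = x_l for |l| > n. Then each σ_n is a homeomorphism satisfying σ_n^{2n+1} = id, and σ_n → σ and σ_n⁻¹ → σ⁻¹ uniformly (with respect to the unique uniform structure on the compact space Y^ℤ) as n → ∞. -/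
/-- Precomposition with a permutation of the index set, as a homeomorphism of a power of `Y`. -/
def Homeomorph.precompPerm {ι : Type*} (Y : Type*) [TopologicalSpace Y] (e : Equiv.Perm ι) :
    (ι → Y) ≃ₜ (ι → Y) where
  toFun x := x ∘ e
  invFun x := x ∘ e.symm
  left_inv x := by ext; simp
  right_inv x := by ext; simp
  continuous_toFun := by fun_prop
  continuous_invFun := by fun_prop

/-- The permutation of `ℤ` that cyclically lowers the window `[-n, n]` by one
and fixes everything else. -/
def windowCycle (n : ℕ) : Equiv.Perm ℤ where
  toFun l := if -(n : ℤ) < l ∧ l ≤ n then l - 1 else if l = -(n : ℤ) then n else l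
  invFun l := if -(n : ℤ) ≤ l ∧ l < n then l + 1 else if l = n then -(n : ℤ) else l
  left_inv l := by grind
  right_inv l := by grind

theorem windowCycle_apply (n : ℕ) (l : ℤ) : windowCycle n l =
    if -(n : ℤ) < l ∧ l ≤ n then l - 1 else if l = -(n : ℤ) then n else l := rfl

theorem windowCycle_symm_apply (n : ℕ) (l : ℤ) : (windowCycle n).symm l =
    if -(n : ℤ) ≤ l ∧ l < n then l + 1 else if l = n then -(n : ℤ) else l := rfl

theorem windowCycle_iterate_apply (n k : ℕ) (hk : k ≤ 2 * n + 1) (l : ℤ) :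
    (windowCycle n)^[k] l =
      if -(n : ℤ) ≤ l ∧ l ≤ n then (if (k : ℤ) ≤ l + n then l - k else l - k + (2 * n + 1))
      else l := by
  induction k with
  | zero => rw [Function.iterate_zero_apply]; grind
  | succ k ih =>
    rw [Function.iterate_succ_apply', ih (by lia), windowCycle_apply]
    push_cast
    grind

theorem windowCycle_iterate_period (n : ℕ) : (windowCycle n)^[2 * n + 1] = id := by
  ext l
  rw [windowCycle_iterate_apply n _ le_rfl, id]
  push_cast
  grind

theorem iterate_precomp {ι Y : Type*} (e : ι → ι) (k : ℕ) :
    (fun x : ι → Y => x ∘ e)^[k] = fun x => x ∘ e^[k] := by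
  induction k with
  | zero => rfl
  | succ k ih => rw [Function.iterate_succ', ih, Function.iterate_succ]; rfl

/-- Precomposition maps on a power of a uniform space converge uniformly as soon as the index
maps are pointwise eventually equal to the limit index map. -/
theorem tendstoUniformly_precomp {α ι Y : Type*} [UniformSpace Y] {p : Filter α}
    {e : α → ι → ι} {e₀ : ι → ι} (h : ∀ i, ∀ᶠ a in p, e a i = e₀ i) :
    TendstoUniformly (fun a (x : ι → Y) => x ∘ e a) (fun x => x ∘ e₀) p := by
  rw [tendstoUniformly_iff_tendsto, Pi.uniformity]
  simp only [Filter.tendsto_iInf, Filter.tendsto_comap_iff]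
  intro i U hU
  rw [Filter.mem_map]
  filter_upwards [(h i).prod_inl ⊤] with q hq
  simpa [hq] using refl_mem_uniformity hU


/-- Let `Y` be a compact metric space, `σ : Y^ℤ → Y^ℤ` the shift
`(σ x)_l = x_{l-1}`, and for each `n ≥ 1` let `σ_n : Y^ℤ → Y^ℤ` be given by
`(σ_n x)_l = x_{l-1}` for `-n < l ≤ n`, `(σ_n x)_{-n} = x_n`, and `(σ_n x)_l = x_l` for
`|l| > n`.  Then each `σ_n` is a homeomorphism satisfying `σ_n^{2n+1} = id`, and
`σ_n → σ`, `σ_n⁻¹ → σ⁻¹` uniformly (for the unique uniform structure on the compact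
space `Y^ℤ`) as `n → ∞`. -/
theorem shift_approx_by_periodic {Y : Type*} [MetricSpace Y] [CompactSpace Y] :
    ∃ (σ : (ℤ → Y) ≃ₜ (ℤ → Y)) (σn : ℕ → ((ℤ → Y) ≃ₜ (ℤ → Y))),
      (∀ (x : ℤ → Y) (l : ℤ), σ x l = x (l - 1)) ∧
      (∀ (n : ℕ) (x : ℤ → Y) (l : ℤ),
        ((-(n : ℤ) < l ∧ l ≤ (n : ℤ)) → σn n x l = x (l - 1)) ∧
        (l = -(n : ℤ) → σn n x l = x (n : ℤ)) ∧
        ((n : ℤ) < |l| → σn n x l = x l)) ∧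
      (∀ n : ℕ, 1 ≤ n → (⇑(σn n))^[2 * n + 1] = id) ∧
      TendstoUniformly (fun n : ℕ => ⇑(σn n)) (⇑σ) Filter.atTop ∧
      TendstoUniformly (fun n : ℕ => ⇑(σn n).symm) (⇑σ.symm) Filter.atTop := by
  refine ⟨.precompPerm Y (Equiv.subRight 1), fun n => .precompPerm Y (windowCycle n),
    fun _ _ => rfl, fun n x l => ?_, fun n _ => ?_, ?_, ?_⟩
  · change (_ → x (windowCycle n l) = _) ∧ (_ → x (windowCycle n l) = _) ∧
      (_ → x (windowCycle n l) = _)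
    rw [windowCycle_apply]
    refine ⟨fun h => ?_, fun h => ?_, fun h => ?_⟩ <;> congr 1 <;> grind
  · change (fun x : ℤ → Y => x ∘ windowCycle n)^[2 * n + 1] = id
    rw [iterate_precomp, windowCycle_iterate_period]
    rfl
  · refine tendstoUniformly_precomp fun l => ?_
    filter_upwards [Filter.eventually_gt_atTop l.natAbs] with n hn
    rw [windowCycle_apply, Equiv.subRight_apply, if_pos (by lia)]
  · refine tendstoUniformly_precomp fun l => ?_
    filter_upwards [Filter.eventually_gt_atTop l.natAbs] with n hn
    rw [windowCycle_symm_apply, Equiv.subRight_symm_apply, if_pos (by lia)]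
end
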